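/- (Failure of the classical mean value inequality in q-calculus) For every 0<q<1 there exist a function f:[0,2]→ℝ and points x,y∈(0,2] such that |f(x) − f(y)| > ‖D_q f‖_∞^{(0,2]} · |x − y|. In particular, for f defined by f(t)=1 for t∈[1,2] and f(t)=0 for t∈[0,1), one has ‖D_q f‖_∞^{(0,2]} = 1/(1−q), and the inequality |f(1) − f(y)| ≤ ‖D_q f‖_∞^{(0,2]}·|1 − y| fails for suitable y∈(0,1). -/

import Mathlib

open Set

/-- Shifted q-derivative of `f` (with base point `a`). -/
noncomputable def qDeriv (q a : ℝ) (f : ℝ → ℝ) (x : ℝ) : ℝ :=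
  (f x - f (a + q * (x - a))) / ((1 - q) * (x - a))

/-- Shifted q-integral of `f` over `[a,b]`. -/
noncomputable def qIntegral (q a b : ℝ) (f : ℝ → ℝ) : ℝ :=
  (1 - q) * (b - a) * ∑' k : ℕ, q ^ k * f (a + q ^ k * (b - a))

/-- `f` is q-integrable over `[a,b]`. -/
def qIntegrable (q a b : ℝ) (f : ℝ → ℝ) : Prop :=
  Summable fun k : ℕ => q ^ k * f (a + q ^ k * (b - a))

/-- The unit step at `1` has q-derivative of sup norm `1 / (1 - q)` on `(0, 2]`. -/
theorem sSup_abs_qDeriv_step {q : ℝ} (hq1 : q < 1) :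
    sSup ((fun t => |qDeriv q 0 (fun t => if 1 ≤ t then 1 else 0) t|) '' Set.Ioc 0 2) =
      1 / (1 - q) := by
  have hpos : 0 < 1 - q := sub_pos.2 hq1
  refine IsGreatest.csSup_eq ⟨⟨1, ⟨one_pos, one_le_two⟩, ?_⟩, ?_⟩
  · simp [qDeriv, not_le.2 hq1, abs_of_pos hpos]
  · rintro _ ⟨t, ⟨ht, -⟩, rfl⟩
    have hqt : q * t < t := by nlinarith
    simp only [qDeriv, sub_zero, zero_add]
    by_cases h1 : 1 ≤ t
    · by_cases h2 : 1 ≤ q * t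
      · simp [h1, h2, hpos.le]
      · rw [if_pos h1, if_neg h2, sub_zero, abs_of_pos (by positivity)]
        exact one_div_le_one_div_of_le hpos (le_mul_of_one_le_right hpos.le h1)
    · have h2 : ¬ 1 ≤ q * t := fun h => h1 (h.trans hqt.le)
      simp [h1, h2, hpos.le]

/-- The jump of the unit step at `1` exceeds the mean value bound at the point `(1 + q) / 2`. -/
theorem step_exceeds_mean_value_bound {q : ℝ} (hq1 : q < 1) :
    1 / (1 - q) * |1 - (1 + q) / 2| <
      |(fun t : ℝ => if 1 ≤ t then (1 : ℝ) else 0) 1 -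
        (fun t : ℝ => if 1 ≤ t then (1 : ℝ) else 0) ((1 + q) / 2)| := by
  have hpos : 0 < 1 - q := sub_pos.2 hq1
  have h : ¬ 1 ≤ (1 + q) / 2 := by linarith
  have he : 1 - (1 + q) / 2 = (1 - q) / 2 := by ring
  rw [he, abs_of_pos (half_pos hpos)]
  simp only [le_refl, if_true, if_neg h, sub_zero, abs_one]
  field_simp
  norm_num

/-- failure of the classical mean value inequality in q-calculus. -/
theorem stmt_13 (q : ℝ) (hq : 0 < q) (hq1 : q < 1) :
    (∃ f : ℝ → ℝ, ∃ x ∈ Set.Ioc (0 : ℝ) 2, ∃ y ∈ Set.Ioc (0 : ℝ) 2,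
      sSup ((fun t => |qDeriv q 0 f t|) '' Set.Ioc 0 2) * |x - y| < |f x - f y|) ∧
    ∀ f : ℝ → ℝ, (f = fun t => if 1 ≤ t then 1 else 0) →
      sSup ((fun t => |qDeriv q 0 f t|) '' Set.Ioc 0 2) = 1 / (1 - q) ∧
      ∃ y ∈ Set.Ioo (0 : ℝ) 1,
        ¬ |f 1 - f y| ≤ sSup ((fun t => |qDeriv q 0 f t|) '' Set.Ioc 0 2) * |1 - y| := by
  refine ⟨?_, ?_⟩
  · have h0 : (1 + q) / 2 ∈ Set.Ioo (0 : ℝ) 1 := ⟨by linarith, by linarith⟩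
    refine ⟨fun t => if 1 ≤ t then 1 else 0, 1, ⟨one_pos, one_le_two⟩, (1 + q) / 2,
      ⟨h0.1, by linarith [h0.2]⟩, ?_⟩
    rw [sSup_abs_qDeriv_step hq1]
    exact step_exceeds_mean_value_bound hq1
  · rintro f rfl
    refine ⟨sSup_abs_qDeriv_step hq1, (1 + q) / 2, ⟨by linarith, by linarith⟩, ?_⟩
    rw [sSup_abs_qDeriv_step hq1, not_le]
    exact step_exceeds_mean_value_bound hq1
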